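/- arXiv:2209.09420 — 2 statements merged into one kernel-verified Lean document; each statement's English description precedes it below -/
import Mathlib

section
/- Let B be a real number, ρ > 0, and λ > 0. Then for every function q ∈ L¹(B, B+ρ) the following estimate holds: ∫_B^{B+ρ} ( ∫_z^{B+ρ} |q(y)| dy ) e^{2λz} dz ≤ (1/(2λ)) ∫_B^{B+ρ} |q(z)| e^{2λz} dz. -/
open MeasureTheory

/-- Lemma 2.1 of the paper: for `ρ > 0`, `λ > 0` and every
`q ∈ L¹(B, B+ρ)`,
`∫_B^{B+ρ} (∫_z^{B+ρ} |q(y)| dy) e^{2λz} dz ≤ (1/(2λ)) ∫_B^{B+ρ} |q(z)| e^{2λz} dz`. -/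
theorem carleman_weight_estimate
    (B ρ lam : ℝ) (hρ : 0 < ρ) (hlam : 0 < lam)
    (q : ℝ → ℝ) (hq : IntegrableOn q (Set.Ioo B (B + ρ))) :
    (∫ z in B..(B + ρ), (∫ y in z..(B + ρ), |q y|) * Real.exp (2 * lam * z))
      ≤ (1 / (2 * lam)) * ∫ z in B..(B + ρ), |q z| * Real.exp (2 * lam * z) := by
  set b := B + ρ
  have hBb : B ≤ b := le_add_of_nonneg_right hρ.le
  have habs : IntervalIntegrable (fun y ↦ |q y|) volume B b :=
    ((intervalIntegrable_iff_integrableOn_Ioo_of_le hBb).2 hq).abs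
  let F : ℝ → ℝ := fun z ↦ ∫ y in b..z, |q y|
  let w : ℝ → ℝ := fun z ↦ Real.exp (2 * lam * z) / (2 * lam)
  have hF : AbsolutelyContinuousOnInterval F B b :=
    habs.absolutelyContinuousOnInterval_intervalIntegral Set.right_mem_uIcc
  have hw : AbsolutelyContinuousOnInterval w B b :=
    ContDiffOn.absolutelyContinuousOnInterval (by fun_prop)
  have hw' : deriv w = fun z ↦ Real.exp (2 * lam * z) := by
    funext z
    have h := (((hasDerivAt_id z).const_mul (2 * lam)).exp.div_const (2 * lam)).deriv
    simp only [id, mul_one] at h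
    rw [h]
    field_simp
  have hF' : ∫ z in B..b, deriv F z * w z
      = (1 / (2 * lam)) * ∫ z in B..b, |q z| * Real.exp (2 * lam * z) := by
    rw [← intervalIntegral.integral_const_mul]
    apply intervalIntegral.integral_congr_ae
    filter_upwards [habs.ae_hasDerivAt_integral] with z hz hzm
    rw [(hz (Set.uIoc_subset_uIcc hzm) b Set.right_mem_uIcc).deriv]
    simp only [w]
    ring
  have hparts := hF.integral_mul_deriv_eq_deriv_mul hw
  rw [hF', hw'] at hparts
  have hlhs : (∫ z in B..b, (∫ y in z..b, |q y|) * Real.exp (2 * lam * z))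
      = -∫ z in B..b, F z * Real.exp (2 * lam * z) := by
    rw [← intervalIntegral.integral_neg]
    congr 1
    funext z
    rw [intervalIntegral.integral_symm b z, neg_mul]
  have hFb : F b = 0 := intervalIntegral.integral_same
  have hFB : F B ≤ 0 := by
    simp only [F]
    rw [intervalIntegral.integral_symm, neg_nonpos]
    exact intervalIntegral.integral_nonneg hBb fun _ _ ↦ abs_nonneg _
  have hwB : 0 ≤ w B := by positivity
  rw [hlhs, hparts, hFb]
  linarith [mul_nonpos_of_nonpos_of_nonneg hFB hwB]
end

section
/- Let a < b be real numbers and let {Φ_n}_{n=0}^∞ be the orthonormal system obtained by Gram–Schmidt orthonormalization in L²(a,b) of the family ψ_n(t) = t^n e^t, with smooth representatives Φ_n(t) = Q_n(t) e^t. Then for every n ≥ 0 the inner product a_{nn} = ∫_a^b Φ_n(t) Φ_n'(t) dt equals 1. -/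
open MeasureTheory

/-- If `Q k` has degree exactly `k` for every `k < n`, then a linear functional that vanishes on
every `Q k` with `k < n` vanishes on all polynomials of degree less than `n`. -/
theorem Polynomial.linearMap_eq_zero_of_degree_lt {K M : Type*} [Field K] [AddCommGroup M]
    [Module K M] (L : Polynomial K →ₗ[K] M) (Q : ℕ → Polynomial K) (n : ℕ)
    (hdeg : ∀ k < n, (Q k).degree = k) (hL : ∀ k < n, L (Q k) = 0)
    (P : Polynomial K) (hP : P.degree < n) : L P = 0 := by
  induction n generalizing P with
  | zero => simp_all
  | succ n ih =>
    have hQ := hdeg n n.lt_succ_self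
    have hlead : (Q n).coeff n ≠ 0 := Polynomial.coeff_ne_zero_of_eq_degree hQ
    set c := P.coeff n / (Q n).coeff n
    have hR : (P - c • Q n).degree < n := by
      rw [Polynomial.degree_lt_iff_coeff_zero] at hP ⊢
      intro m hm
      rcases hm.eq_or_lt with rfl | hm
      · simp [c, hlead]
      · have hQm : (Q n).coeff m = 0 :=
          Polynomial.coeff_eq_zero_of_degree_lt (by rw [hQ]; exact_mod_cast hm)
        simp [hP m hm, hQm]
    have h0 := ih (fun k hk => hdeg k (hk.trans n.lt_succ_self))
      (fun k hk => hL k (hk.trans n.lt_succ_self)) _ hR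
    simpa [hL n n.lt_succ_self] using h0

/-- The linear functional `P ↦ ∫ t in a..b, f t * (P(t) e^t)` on real polynomials. -/
noncomputable def intervalIntegralMulPolynomialExp (a b : ℝ) (f : ℝ → ℝ) (hf : Continuous f) :
    Polynomial ℝ →ₗ[ℝ] ℝ where
  toFun P := ∫ t in a..b, f t * (P.eval t * Real.exp t)
  map_add' P R := by
    rw [← intervalIntegral.integral_add]
    · simp only [Polynomial.eval_add, add_mul, mul_add]
    all_goals exact Continuous.intervalIntegrable (by fun_prop) _ _
  map_smul' c P := by
    rw [RingHom.id_apply, smul_eq_mul, ← intervalIntegral.integral_const_mul]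
    congr with t
    simp only [Polynomial.eval_smul, smul_eq_mul]
    ring

/-- The derivative of `t ↦ P(t) e^t` is `t ↦ (P'(t) + P(t)) e^t`. -/
theorem Polynomial.deriv_eval_mul_exp (P : Polynomial ℝ) (t : ℝ) :
    deriv (fun t => P.eval t * Real.exp t) t = (P.derivative + P).eval t * Real.exp t := by
  rw [((P.hasDerivAt t).fun_mul (Real.hasDerivAt_exp t)).deriv, Polynomial.eval_add, add_mul]

/-- let `{Φ_n}` be the orthonormal system obtained by Gram–Schmidt
orthonormalization in `L²(a,b)` of the family `ψ_n(t) = t^n e^t`, with smooth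
representatives `Φ_n(t) = Q_n(t) e^t`, `Q_n` a polynomial of degree exactly `n`.
Then for every `n ≥ 0` the inner product `a_{nn} = ∫_a^b Φ_n(t) Φ_n'(t) dt` equals `1`. -/
theorem diagonal_inner_product_eq_one
    (a b : ℝ) (hab : a < b)
    (Φ : ℕ → ℝ → ℝ) (Q : ℕ → Polynomial ℝ)
    (hdeg : ∀ n : ℕ, (Q n).degree = n)
    (hrep : ∀ n t, Φ n t = (Q n).eval t * Real.exp t)
    (horth : ∀ m n : ℕ, (∫ t in a..b, Φ m t * Φ n t) = if m = n then (1 : ℝ) else 0) :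
    ∀ n : ℕ, (∫ t in a..b, Φ n t * deriv (Φ n) t) = 1 := by
  intro n
  have hΦ : ∀ k, Φ k = fun t => (Q k).eval t * Real.exp t := fun k => funext (hrep k)
  have hcont : Continuous (Φ n) := by rw [hΦ]; fun_prop
  let L := intervalIntegralMulPolynomialExp a b (Φ n) hcont
  have hLQ : ∀ k, L (Q k) = if n = k then (1 : ℝ) else 0 := fun k => by
    rw [← horth n k, hΦ k]
    rfl
  have hne : Q n ≠ 0 := fun h => by simpa [h] using hdeg n
  have hder : L (Q n).derivative = 0 :=
    Polynomial.linearMap_eq_zero_of_degree_lt L Q n (fun k _ => hdeg k)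
      (fun k hk => by rw [hLQ, if_neg hk.ne']) _
      (hdeg n ▸ Polynomial.degree_derivative_lt hne)
  calc (∫ t in a..b, Φ n t * deriv (Φ n) t) = L ((Q n).derivative + Q n) := by
        refine intervalIntegral.integral_congr fun t _ => ?_
        rw [← Polynomial.deriv_eval_mul_exp, ← hΦ]
    _ = 1 := by rw [map_add, hder, hLQ, if_pos rfl, zero_add]
end
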